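/- If 𝕋 is a hyperaffine algebraic theory, then every pair of operations commutes: for all t ∈ T(I) and u ∈ T(J), one has t(λi. u(λj. x_{ij})) = u(λj. t(λi. x_{ij})); precisely, substituting the family (λi. u(λj. π_{(i,j)})) into t equals substituting the family (λj. t(λi. π_{(i,j)})) into u, as elements of T(I × J). -/

import Mathlib

/-- An (infinitary) algebraic theory: for each set (type) `I` a set `T I` of
`I`-ary operations, with projections and substitution. -/
structure AlgTheory where
  T : Type → Type
  pr : ∀ {I : Type}, I → T I
  subst : ∀ {I J : Type}, T I → (I → T J) → T J
  subst_pr : ∀ {I : Type} (t : T I), subst t (fun i => pr i) = t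
  pr_subst : ∀ {I J : Type} (i : I) (u : I → T J), subst (pr i) u = u i
  subst_assoc : ∀ {I J K : Type} (t : T I) (u : I → T J) (v : J → T K),
      subst (subst t u) v = subst t (fun i => subst (u i) v)

/-- `t` is affine: `t(λi. π₁) = π₁` in `T 1`. -/
def AlgTheory.IsAffine (𝕋 : AlgTheory) {I : Type} (t : 𝕋.T I) : Prop :=
  𝕋.subst t (fun _ => 𝕋.pr PUnit.unit) = 𝕋.pr PUnit.unit

/-- `t` is hyperaffine: affine, and `t(λi. t(λj. π_{(i,j)})) = t(λi. π_{(i,i)})`. -/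
def AlgTheory.IsHyperaffine (𝕋 : AlgTheory) {I : Type} (t : 𝕋.T I) : Prop :=
  𝕋.IsAffine t ∧
  𝕋.subst t (fun i => 𝕋.subst t (fun j => 𝕋.pr (i, j))) =
    𝕋.subst t (fun i => 𝕋.pr (i, i))

/-- Substituting a constant family into an affine operation returns the constant. -/
theorem AlgTheory.IsAffine.subst_const {𝕋 : AlgTheory} {I J : Type} {t : 𝕋.T I}
    (ht : 𝕋.IsAffine t) (a : 𝕋.T J) : 𝕋.subst t (fun _ => a) = a := by
  have h := congrArg (fun s => 𝕋.subst s (fun _ => a)) ht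
  simpa only [𝕋.subst_assoc, 𝕋.pr_subst] using h

/-- In a hyperaffine algebraic theory, every pair of operations commutes. -/
theorem hyperaffine_operations_commute (𝕋 : AlgTheory)
    (hyp : ∀ (I : Type) (t : 𝕋.T I), 𝕋.IsHyperaffine t)
    (I J : Type) (t : 𝕋.T I) (u : 𝕋.T J) :
    𝕋.subst t (fun i => 𝕋.subst u (fun j => 𝕋.pr (i, j))) =
      𝕋.subst u (fun j => 𝕋.subst t (fun i => 𝕋.pr (i, j))) := by
  have h := congrArg (fun s => 𝕋.subst s (fun p => 𝕋.pr (p.2.1, p.1.2)))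
    (hyp _ (𝕋.subst t (fun i => 𝕋.subst u (fun j => 𝕋.pr (i, j))))).2
  simp only [𝕋.subst_assoc, 𝕋.pr_subst, (hyp _ u).1.subst_const, (hyp _ t).1.subst_const] at h
  exact h.symm
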